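/- Let a, b, c > 0. Then for z ∈ (0,1) the function M satisfies the differentiation formula: dM(a,b,c,z)/dz = (1/(z(1−z)))·( (c−a)[(1−c+(a+b−1)z)·u(z)v₁(z) + (−a−b+c+(a+b−1)z)·u₁(z)v(z)] + (1−2z)·[(c−a)(a+2b−1) − b²]·v(z)v₁(z) ). -/

import Mathlib

open Filter Set

/-- Shifted factorial (Appell symbol) `(a,n) = a(a+1)⋯(a+n−1)`, with `(a,0)=1`. -/
noncomputable def shiftedFact (a : ℝ) (n : ℕ) : ℝ := ∏ i ∈ Finset.range n, (a + i)

/-- Gaussian hypergeometric function `F(a,b;c;x)` as a real power series. -/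
noncomputable def hypF (a b c x : ℝ) : ℝ :=
  ∑' n : ℕ, (shiftedFact a n * shiftedFact b n / (shiftedFact c n * (n.factorial : ℝ))) * x ^ n

/-- Beta function `B(x,y) = Γ(x)Γ(y)/Γ(x+y)`. -/
noncomputable def betaR (x y : ℝ) : ℝ := Real.Gamma x * Real.Gamma y / Real.Gamma (x + y)

/-- `M(a,b,c,x) = x(1−x)(v₁(x)v'(x) − v(x)v₁'(x))` with `v(x)=F(a,b;c;x)`, `v₁(x)=F(a,b;c;1−x)`. -/
noncomputable def Mfun (a b c x : ℝ) : ℝ :=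
  x * (1 - x) * (hypF a b c (1 - x) * deriv (fun t => hypF a b c t) x
    - hypF a b c x * deriv (fun t => hypF a b c (1 - t)) x)

/-- The `n`-th Taylor coefficient of `hypF a b c`. -/
noncomputable def hypCoeff (a b c : ℝ) (n : ℕ) : ℝ :=
  shiftedFact a n * shiftedFact b n / (shiftedFact c n * (n.factorial : ℝ))

lemma shiftedFact_succ (a : ℝ) (n : ℕ) :
    shiftedFact a (n + 1) = shiftedFact a n * (a + n) := by
  simp [shiftedFact, Finset.prod_range_succ]

lemma shiftedFact_succ_left (a : ℝ) (n : ℕ) :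
    shiftedFact (a - 1) (n + 1) = (a - 1) * shiftedFact a n := by
  simp only [shiftedFact, Finset.prod_range_succ']
  rw [mul_comm]
  congr 1
  · simp
  · refine Finset.prod_congr rfl fun i _ => ?_
    push_cast
    ring

lemma shiftedFact_pos {c : ℝ} (hc : 0 < c) (n : ℕ) : 0 < shiftedFact c n :=
  Finset.prod_pos fun i _ => by positivity

@[simp] lemma hypCoeff_zero (a b c : ℝ) : hypCoeff a b c 0 = 1 := by
  simp [hypCoeff, shiftedFact]

lemma hypCoeff_succ (a b : ℝ) {c : ℝ} (hc : 0 < c) (n : ℕ) :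
    hypCoeff a b c (n + 1) = hypCoeff a b c n * ((a + n) * (b + n) / ((c + n) * (n + 1))) := by
  have := (shiftedFact_pos hc n).ne'
  have : (n.factorial : ℝ) ≠ 0 := by positivity
  have : c + n ≠ 0 := by positivity
  simp only [hypCoeff, shiftedFact_succ, Nat.factorial_succ]
  push_cast
  field_simp

lemma hypCoeff_sub_one_succ (a b : ℝ) {c : ℝ} (hc : 0 < c) (n : ℕ) :
    hypCoeff (a - 1) b c (n + 1) =
      hypCoeff a b c n * ((a - 1) * (b + n) / ((c + n) * (n + 1))) := by
  have := (shiftedFact_pos hc n).ne'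
  have : (n.factorial : ℝ) ≠ 0 := by positivity
  have : c + n ≠ 0 := by positivity
  simp only [hypCoeff, shiftedFact_succ_left, shiftedFact_succ b, shiftedFact_succ c,
    Nat.factorial_succ]
  push_cast
  field_simp

lemma natCast_mul_hypCoeff_sub_one (a b c : ℝ) (n : ℕ) :
    n * hypCoeff (a - 1) b c n = (a - 1) * (hypCoeff a b c n - hypCoeff (a - 1) b c n) := by
  have h := (shiftedFact_succ (a - 1) n).symm.trans (shiftedFact_succ_left a n)
  simp only [hypCoeff]
  linear_combination (shiftedFact b n / (shiftedFact c n * (n.factorial : ℝ))) * h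

lemma tendsto_hypCoeff_ratio (a b c : ℝ) :
    Tendsto (fun n : ℕ => (a + n) * (b + n) / ((c + n) * (n + 1))) atTop (nhds 1) := by
  have key (p q : ℝ) : Tendsto (fun n : ℕ => (p + n) / (q + n)) atTop (nhds 1) := by
    simpa using tendsto_add_mul_div_add_mul_atTop_nhds p q (1 : ℝ) (one_ne_zero (α := ℝ))
  have h := (key a c).mul (key b 1)
  simp only [mul_one] at h
  refine h.congr fun n => ?_
  rw [div_mul_div_comm, add_comm (1 : ℝ)]

lemma summable_hypCoeff (a b : ℝ) {c x : ℝ} (hc : 0 < c) (hx : |x| < 1) :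
    Summable fun n => hypCoeff a b c n * x ^ n := by
  obtain ⟨r, hxr, hr⟩ := exists_between hx
  refine summable_of_ratio_norm_eventually_le hr ?_
  have h := ((tendsto_hypCoeff_ratio a b c).mul_const x).abs
  rw [one_mul] at h
  filter_upwards [h.eventually_lt_const hxr] with n hn
  have e : hypCoeff a b c (n + 1) * x ^ (n + 1) =
      (a + n) * (b + n) / ((c + n) * (n + 1)) * x * (hypCoeff a b c n * x ^ n) := by
    rw [hypCoeff_succ a b hc]
    ring
  rw [e, norm_mul, Real.norm_eq_abs]
  gcongr

lemma summable_hypCoeff_deriv (a b : ℝ) {c x : ℝ} (hc : 0 < c) (hx : |x| < 1) :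
    Summable fun n : ℕ => hypCoeff a b c n * (n * x ^ (n - 1)) := by
  rw [← summable_nat_add_iff 1]
  refine ((summable_hypCoeff (a + 1) (b + 1) (add_pos hc one_pos) hx).mul_left
    (a * b / c)).congr fun n => ?_
  have h (p : ℝ) : shiftedFact p (n + 1) = p * shiftedFact (p + 1) n := by
    simpa using shiftedFact_succ_left (p + 1) n
  have := (shiftedFact_pos (add_pos hc one_pos) n).ne'
  have : (n.factorial : ℝ) ≠ 0 := by positivity
  simp only [hypCoeff, h, Nat.factorial_succ, Nat.add_sub_cancel]
  push_cast
  field_simp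

lemma hasDerivAt_hypF (a b : ℝ) {c x : ℝ} (hc : 0 < c) (hx : |x| < 1) :
    HasDerivAt (hypF a b c) (∑' n : ℕ, hypCoeff a b c n * (n * x ^ (n - 1))) x := by
  obtain ⟨r, hxr, hr⟩ := exists_between hx
  have hr0 : 0 < r := (abs_nonneg x).trans_lt hxr
  have hr' : |r| < 1 := by rwa [abs_of_pos hr0]
  refine hasDerivAt_tsum_of_isPreconnected (t := Metric.ball 0 r) (y₀ := 0)
    (summable_hypCoeff_deriv a b hc hr').norm Metric.isOpen_ball
    (convex_ball (0 : ℝ) r).isPreconnected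
    (fun n y _ => (hasDerivAt_pow n y).const_mul (hypCoeff a b c n)) (fun n y hy => ?_)
    (Metric.mem_ball_self hr0) (summable_hypCoeff a b hc (by simp)) (by simpa using hxr)
  have hy : |y| < r := by simpa using hy
  simp only [norm_mul, norm_pow, Real.norm_eq_abs, abs_of_pos hr0]
  gcongr

lemma hasSum_hypF (a b : ℝ) {c x : ℝ} (hc : 0 < c) (hx : |x| < 1) :
    HasSum (fun n => hypCoeff a b c n * x ^ n) (hypF a b c x) :=
  (summable_hypCoeff a b hc hx).hasSum

lemma hasSum_mul_deriv_hypF (a b : ℝ) {c x : ℝ} (hc : 0 < c) (hx : |x| < 1) :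
    HasSum (fun n : ℕ => n * hypCoeff a b c n * x ^ n) (x * deriv (hypF a b c) x) := by
  rw [(hasDerivAt_hypF a b hc hx).deriv]
  refine ((summable_hypCoeff_deriv a b hc hx).hasSum.mul_left x).congr_fun fun n => ?_
  cases n with
  | zero => simp
  | succ n =>
    rw [Nat.add_sub_cancel]
    ring

lemma mul_deriv_hypF_sub_one (a b : ℝ) {c x : ℝ} (hc : 0 < c) (hx : |x| < 1) :
    x * deriv (hypF (a - 1) b c) x = (a - 1) * (hypF a b c x - hypF (a - 1) b c x) := by
  refine (hasSum_mul_deriv_hypF (a - 1) b hc hx).unique ?_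
  refine (((hasSum_hypF a b hc hx).sub (hasSum_hypF (a - 1) b hc hx)).mul_left
    (a - 1)).congr_fun fun n => ?_
  rw [natCast_mul_hypCoeff_sub_one]
  ring

lemma mul_one_sub_mul_deriv_hypF (a b : ℝ) {c x : ℝ} (hc : 0 < c) (hx : |x| < 1) :
    x * (1 - x) * deriv (hypF a b c) x =
      (c - a) * hypF (a - 1) b c x + (a - c + b * x) * hypF a b c x := by
  have hv := hasSum_hypF a b hc hx
  have hd := hasSum_mul_deriv_hypF a b hc hx
  have h₁ := (hd.sub ((hasSum_hypF (a - 1) b hc hx).mul_left (c - a))).sub (hv.mul_left (a - c))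
  have h₂ := (hd.add (hv.mul_left b)).mul_left x
  rw [← hasSum_nat_add_iff' 1] at h₁
  have h := h₁.unique (h₂.congr_fun fun n => ?_)
  · simp at h
    linear_combination h
  · rw [hypCoeff_succ a b hc, hypCoeff_sub_one_succ a b hc]
    have : c + n ≠ 0 := by positivity
    push_cast
    field_simp
    ring

lemma Mfun_eq (a b : ℝ) {c x : ℝ} (hc : 0 < c) (hx : x ∈ Ioo (0 : ℝ) 1) :
    Mfun a b c x =
      (c - a) * (hypF (a - 1) b c x * hypF a b c (1 - x)
        + hypF (a - 1) b c (1 - x) * hypF a b c x)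
      + (2 * (a - c) + b) * (hypF a b c x * hypF a b c (1 - x)) := by
  have h := mul_one_sub_mul_deriv_hypF a b hc (abs_lt.2 ⟨by linarith [hx.1], hx.2⟩)
  have h' := mul_one_sub_mul_deriv_hypF a b hc (x := 1 - x)
    (abs_lt.2 ⟨by linarith [hx.2], by linarith [hx.1]⟩)
  rw [Mfun, deriv_comp_const_sub (f := hypF a b c)]
  linear_combination hypF a b c (1 - x) * h + hypF a b c x * h'

theorem stmt9 (a b c : ℝ) (ha : 0 < a) (hb : 0 < b) (hc : 0 < c) :
    ∀ z ∈ Set.Ioo (0 : ℝ) 1,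
      deriv (fun t => Mfun a b c t) z =
        (1 / (z * (1 - z))) *
          ((c - a) * ((1 - c + (a + b - 1) * z) * hypF (a - 1) b c z * hypF a b c (1 - z)
              + (-a - b + c + (a + b - 1) * z) * hypF (a - 1) b c (1 - z) * hypF a b c z)
            + (1 - 2 * z) * ((c - a) * (a + 2 * b - 1) - b ^ 2) *
                hypF a b c z * hypF a b c (1 - z)) := by
  intro z hz
  have hx : |z| < 1 := abs_lt.2 ⟨by linarith [hz.1], hz.2⟩
  have hx' : |1 - z| < 1 := abs_lt.2 ⟨by linarith [hz.2], by linarith [hz.1]⟩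
  have hM : (fun t => Mfun a b c t) =ᶠ[nhds z] _ :=
    eventually_of_mem (Ioo_mem_nhds hz.1 hz.2) fun t ht => Mfun_eq a b hc ht
  have hd (p : ℝ) {y : ℝ} (hy : |y| < 1) :
      HasDerivAt (hypF p b c) (deriv (hypF p b c) y) y :=
    (hasDerivAt_hypF p b hc hy).differentiableAt.hasDerivAt
  have hu := hd (a - 1) hx
  have hv := hd a hx
  have hu₁ := (hd (a - 1) hx').comp_const_sub 1 z
  have hv₁ := (hd a hx').comp_const_sub 1 z
  have hD := (((hu.fun_mul hv₁).fun_add (hu₁.fun_mul hv)).const_mul (c - a)).fun_add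
    ((hv.fun_mul hv₁).const_mul (2 * (a - c) + b))
  rw [hM.deriv_eq, hD.deriv, one_div_mul_eq_div, eq_div_iff (by nlinarith [hz.1, hz.2])]
  have e₁ := mul_deriv_hypF_sub_one a b hc hx
  have e₂ := mul_deriv_hypF_sub_one a b hc hx'
  have e₃ := mul_one_sub_mul_deriv_hypF a b hc hx
  have e₄ := mul_one_sub_mul_deriv_hypF a b hc hx'
  linear_combination
    (c - a) * (1 - z) * hypF a b c (1 - z) * e₁ - (c - a) * z * hypF a b c z * e₂
    + ((c - a) * hypF (a - 1) b c (1 - z) + (2 * (a - c) + b) * hypF a b c (1 - z)) * e₃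
    - ((c - a) * hypF (a - 1) b c z + (2 * (a - c) + b) * hypF a b c z) * e₄
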